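/- Let α1, α2 ∈ K with (3α1−α2)(α1+α2) ≠ 0. In D_3(α1,α2) define the central idempotents e1 = (3α1−α2)⁻¹·((b+c)² − (α1+α2)), e2 = (3α1−α2)⁻¹·((a+c)² − (α1+α2)), e3 = (3α1−α2)⁻¹·((a+b)² − (α1+α2)). Then for each i ∈ {1,2,3}, the quotient of D_3(α1,α2) by the two-sided ideal generated by 1−e_i is a simple ring, isomorphic as a K-algebra to the 2×2 matrix algebra M_2(K). -/

import Mathlib

noncomputable section

open FreeAlgebra

/-- The defining relations of the PBW deformation `D₃(α₁, α₂)` of the Fomin–Kirillov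
algebra `E₃`: with generators `a = ι K 0`, `b = ι K 1`, `c = ι K 2`, the relations are
`a² = b² = c² = α₁`, `ca + bc + ab = α₂` and `cb + ba + ac = α₂`. -/
inductive D3Rel (K : Type) [Field K] (α1 α2 : K) :
    FreeAlgebra K (Fin 3) → FreeAlgebra K (Fin 3) → Prop
  | ra : D3Rel K α1 α2 (ι K (0 : Fin 3) * ι K (0 : Fin 3))
      (algebraMap K (FreeAlgebra K (Fin 3)) α1)
  | rb : D3Rel K α1 α2 (ι K (1 : Fin 3) * ι K (1 : Fin 3))
      (algebraMap K (FreeAlgebra K (Fin 3)) α1)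
  | rc : D3Rel K α1 α2 (ι K (2 : Fin 3) * ι K (2 : Fin 3))
      (algebraMap K (FreeAlgebra K (Fin 3)) α1)
  | r1 : D3Rel K α1 α2
      (ι K (2 : Fin 3) * ι K (0 : Fin 3) + ι K (1 : Fin 3) * ι K (2 : Fin 3) +
        ι K (0 : Fin 3) * ι K (1 : Fin 3))
      (algebraMap K (FreeAlgebra K (Fin 3)) α2)
  | r2 : D3Rel K α1 α2
      (ι K (2 : Fin 3) * ι K (1 : Fin 3) + ι K (1 : Fin 3) * ι K (0 : Fin 3) +
        ι K (0 : Fin 3) * ι K (2 : Fin 3))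
      (algebraMap K (FreeAlgebra K (Fin 3)) α2)

/-- The algebra `D₃(α₁, α₂)`: the quotient of the free algebra `K⟨a,b,c⟩` by the two-sided
ideal generated by the relations above. -/
abbrev D3 (K : Type) [Field K] (α1 α2 : K) : Type := RingQuot (D3Rel K α1 α2)

/-- The generator `a` of `D₃(α₁, α₂)`. -/
def D3a (K : Type) [Field K] (α1 α2 : K) : D3 K α1 α2 :=
  RingQuot.mkAlgHom K (D3Rel K α1 α2) (ι K (0 : Fin 3))

/-- The generator `b` of `D₃(α₁, α₂)`. -/
def D3b (K : Type) [Field K] (α1 α2 : K) : D3 K α1 α2 :=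
  RingQuot.mkAlgHom K (D3Rel K α1 α2) (ι K (1 : Fin 3))

/-- The generator `c` of `D₃(α₁, α₂)`. -/
def D3c (K : Type) [Field K] (α1 α2 : K) : D3 K α1 α2 :=
  RingQuot.mkAlgHom K (D3Rel K α1 α2) (ι K (2 : Fin 3))

section Clifford

variable {K D : Type*} [Field K] [Ring D] [Algebra K D]

/-- A pair of generators with scalar squares and scalar anticommutator spans, together with
`1` and their product, the whole algebra. -/
theorem exists_coords_of_adjoin_pair {p r : K} {x y : D}
    (hx : x * x = algebraMap K D p) (hy : y * y = algebraMap K D p)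
    (hxy : x * y + y * x = algebraMap K D r) (htop : Algebra.adjoin K {x, y} = ⊤) (d : D) :
    ∃ k : Fin 4 → K, d = k 0 • 1 + k 1 • x + k 2 • y + k 3 • (x * y) := by
  have hyx : y * x = r • 1 - x * y := by
    rw [← Algebra.algebraMap_eq_smul_one, ← hxy]; abel
  rw [Algebra.algebraMap_eq_smul_one] at hx hy
  suffices H : ∀ d ∈ Algebra.adjoin K {x, y}, ∀ k : Fin 4 → K, ∃ l : Fin 4 → K,
      d * (k 0 • 1 + k 1 • x + k 2 • y + k 3 • (x * y)) =
        l 0 • 1 + l 1 • x + l 2 • y + l 3 • (x * y) by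
    obtain ⟨l, hl⟩ := H d (htop ▸ Algebra.mem_top) ![1, 0, 0, 0]
    exact ⟨l, by simpa using hl⟩
  intro d hd
  induction hd using Algebra.adjoin_induction with
  | mem d hd =>
    intro k
    rcases hd with rfl | rfl
    · refine ⟨![p * k 1, k 0, p * k 3, k 2], ?_⟩
      simp only [mul_add, mul_smul_comm, ← mul_assoc, hx, mul_one, smul_mul_assoc, one_mul,
        Matrix.cons_val]
      module
    · refine ⟨![r * k 1 + p * k 2, - p * k 3, k 0 + r * k 3, - k 1], ?_⟩
      simp only [mul_add, mul_smul_comm, ← mul_assoc, hyx, hy, mul_one, smul_mul_assoc, one_mul,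
        sub_mul, Matrix.cons_val]
      simp only [mul_assoc, hy, mul_smul_comm, mul_one]
      module
  | algebraMap s =>
    intro k
    refine ⟨fun i => s * k i, ?_⟩
    rw [← Algebra.smul_def]
    module
  | add d e _ _ hd he =>
    intro k
    obtain ⟨l, hl⟩ := hd k
    obtain ⟨m, hm⟩ := he k
    refine ⟨fun i => l i + m i, ?_⟩
    rw [add_mul, hl, hm]
    module
  | mul d e _ _ hd he =>
    intro k
    obtain ⟨m, hm⟩ := he k
    obtain ⟨l, hl⟩ := hd m
    exact ⟨l, by rw [mul_assoc, hm, hl]⟩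

/-- An algebra generated by `x`, `y` with `x² = y² = s²` and `xy + yx = r`, where
`4s⁴ ≠ r²`, is sent isomorphically onto the matrix algebra by the representation below. -/
theorem bijective_of_clifford_pair {s r : K} (hdet : (2 * s ^ 2 - r) * (2 * s ^ 2 + r) ≠ 0)
    {x y : D} (hx : x * x = algebraMap K D (s ^ 2)) (hy : y * y = algebraMap K D (s ^ 2))
    (hxy : x * y + y * x = algebraMap K D r) (htop : Algebra.adjoin K {x, y} = ⊤)
    (f : D →ₐ[K] Matrix (Fin 2) (Fin 2) K)
    (hfx : f x = !![0, 1; s ^ 2, 0]) (hfy : f y = !![s, 0; r, -s]) :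
    Function.Bijective f := by
  let g : (Fin 4 → K) →ₗ[K] D :=
    Fintype.linearCombination K ![1, x, y, x * y]
  have hg (k : Fin 4 → K) : g k = k 0 • 1 + k 1 • x + k 2 • y + k 3 • (x * y) := by
    simp [g, Fintype.linearCombination_apply, Fin.sum_univ_four]
  have hgs : Function.Surjective g := fun d => by
    obtain ⟨k, hk⟩ := exists_coords_of_adjoin_pair hx hy hxy htop d
    exact ⟨k, by rw [hg, hk]⟩
  have hinj : Function.Injective (f.toLinearMap ∘ₗ g) := by
    rw [injective_iff_map_eq_zero]
    intro k hk
    have hk' : f (g k) = 0 := hk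
    simp only [hg, map_add, map_smul, map_one, map_mul, hfx, hfy] at hk'
    have h00 := congrFun (congrFun hk' 0) 0
    have h01 := congrFun (congrFun hk' 0) 1
    have h10 := congrFun (congrFun hk' 1) 0
    have h11 := congrFun (congrFun hk' 1) 1
    simp at h00 h01 h10 h11
    have h3 : k 3 = 0 := by
      refine (mul_eq_zero.mp ?_).resolve_left hdet
      linear_combination (-r) * h00 + (-2 * s ^ 3) * h01 + (2 * s) * h10 + r * h11
    have h1 : k 1 = 0 := by linear_combination h01 + s * h3
    have h2 : k 2 = 0 := by
      refine (mul_eq_zero.mp ?_).resolve_left hdet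
      linear_combination 2 * s ^ 3 * (h00 - h11) - r * (h10 - s ^ 2 * h01)
    have h0 : k 0 = 0 := by linear_combination h11 + s * h2
    funext i
    fin_cases i <;> assumption
  have hbij : Function.Bijective (f.toLinearMap ∘ₗ g) :=
    ⟨hinj, (LinearMap.injective_iff_surjective_of_finrank_eq_finrank
      (by simp [Module.finrank_matrix])).mp hinj⟩
  exact ⟨fun u v huv => by
      obtain ⟨k, rfl⟩ := hgs u
      obtain ⟨l, rfl⟩ := hgs v
      rw [hinj huv], fun m => (hbij.2 m).imp' g fun _ h => h⟩

/-- In characteristic not two, the relations of `D₃` together with `(y + z)² = 4p` collapse the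
generators `y` and `z`. -/
theorem eq_of_relations_of_sq_add {p q : K} (h2 : (2 : K) ≠ 0) (hpq : 3 * p - q ≠ 0) {x y z : D}
    (hx : x * x = algebraMap K D p) (hy : y * y = algebraMap K D p)
    (hz : z * z = algebraMap K D p) (h1 : z * x + y * z + x * y = algebraMap K D q)
    (h1' : z * y + y * x + x * z = algebraMap K D q)
    (he : (y + z) ^ 2 = algebraMap K D (4 * p)) : y = z := by
  obtain ⟨n, rfl⟩ : ∃ n, y = z + n := ⟨y - z, by abel⟩
  obtain ⟨d, rfl⟩ : ∃ d, x = z + d := ⟨x - z, by abel⟩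
  simp only [map_mul, map_ofNat] at he
  have hn : n * n = 0 := by
    linear_combination (norm := noncomm_ring) 2 * hy - he + 2 * hz
  have hzn : z * n + n * z = 0 := by
    linear_combination (norm := noncomm_ring) hy - hz - hn
  have hdn : d * n = n * d := by
    linear_combination (norm := noncomm_ring) h1 - h1'
  have hd : d * d + z * d + d * z = 0 := by
    linear_combination (norm := noncomm_ring) hx - hz
  have hdd : 2 * (d * d - d * n) = algebraMap K D (2 * (3 * p - q)) := by
    simp only [map_mul, map_sub, map_ofNat]
    linear_combination (norm := noncomm_ring) 2 * hd - hdn - h1 - h1' + 6 * hz + 2 * hzn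
  have hddn : 2 * (d * d * n) = 0 := by
    linear_combination (norm := noncomm_ring)
      hd * n + n * hd + hdn * d + d * hdn - z * hdn + hdn * z - d * hzn - hzn * d
  have hpn : (2 * (3 * p - q)) • n = 0 := by
    rw [Algebra.smul_def]
    linear_combination (norm := noncomm_ring) hddn - hdd * n - 2 * d * hn
  simpa [h2, hpq] using hpn

/-- If `x`, `y`, `z` generate `D` and satisfy the relations of `D₃(s², q)`, and `D` has the matrix
representation below, then setting `(3s² - q)⁻¹((y + z)² - (s² + q)) = 1` turns `D` into the algebra
of `2 × 2` matrices. -/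
theorem isSimpleRing_and_equiv_matrix_of_relations {s q : K} (h2 : (2 : K) ≠ 0)
    (h : (3 * s ^ 2 - q) * (s ^ 2 + q) ≠ 0) {x y z : D}
    (hx : x * x = algebraMap K D (s ^ 2)) (hy : y * y = algebraMap K D (s ^ 2))
    (hz : z * z = algebraMap K D (s ^ 2)) (h1 : z * x + y * z + x * y = algebraMap K D q)
    (h1' : z * y + y * x + x * z = algebraMap K D q) (htop : Algebra.adjoin K {x, y, z} = ⊤)
    (φ : D →ₐ[K] Matrix (Fin 2) (Fin 2) K) (hφx : φ x = !![0, 1; s ^ 2, 0])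
    (hφy : φ y = !![s, 0; q - s ^ 2, -s]) (hφz : φ z = !![s, 0; q - s ^ 2, -s]) {t : D}
    (ht : t = y + z) :
    IsSimpleRing (RingQuot fun u v : D =>
        u = 1 - (3 * s ^ 2 - q)⁻¹ • (t ^ 2 - algebraMap K D (s ^ 2 + q)) ∧ v = 0) ∧
      Nonempty ((RingQuot fun u v : D =>
        u = 1 - (3 * s ^ 2 - q)⁻¹ • (t ^ 2 - algebraMap K D (s ^ 2 + q)) ∧ v = 0) ≃ₐ[K]
          Matrix (Fin 2) (Fin 2) K) := by
  subst ht
  have hq := left_ne_zero_of_mul h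
  set R : D → D → Prop := fun u v =>
    u = 1 - (3 * s ^ 2 - q)⁻¹ • ((y + z) ^ 2 - algebraMap K D (s ^ 2 + q)) ∧ v = 0
  let π : D →ₐ[K] RingQuot R := RingQuot.mkAlgHom K R
  have hφR : ∀ ⦃u v⦄, R u v → φ u = φ v := by
    rintro _ _ ⟨rfl, rfl⟩
    have hsq : φ ((y + z) ^ 2) = algebraMap K _ (4 * s ^ 2) := by
      rw [map_pow, map_add, hφy, hφz]
      ext i j
      fin_cases i <;> fin_cases j <;> simp [pow_two, Matrix.algebraMap_matrix_apply] <;> ring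
    rw [map_sub, map_smul, map_sub, hsq, AlgHom.commutes, ← map_sub,
      show 4 * s ^ 2 - (s ^ 2 + q) = 3 * s ^ 2 - q by ring,
      Algebra.algebraMap_eq_smul_one, inv_smul_smul₀ hq, map_one, sub_self, map_zero]
  let f : RingQuot R →ₐ[K] Matrix (Fin 2) (Fin 2) K := RingQuot.liftAlgHom K ⟨φ, hφR⟩
  have hf (d : D) : f (π d) = φ d := RingQuot.liftAlgHom_mkAlgHom_apply K φ hφR d
  have he : (π y + π z) ^ 2 = algebraMap K _ (4 * s ^ 2) := by
    have hrel : π _ = π 0 := RingQuot.mkAlgHom_rel K (s := R) ⟨rfl, rfl⟩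
    rw [map_sub, map_smul, map_sub, map_pow, map_add, map_one, map_zero, sub_eq_zero,
      eq_inv_smul_iff₀ hq, ← Algebra.algebraMap_eq_smul_one, AlgHom.commutes,
      eq_sub_iff_add_eq, ← map_add] at hrel
    rw [← hrel]
    congr 1
    ring
  have hπ {u : D} {k : K} (hu : u = algebraMap K D k) : π u = algebraMap K _ k := by
    rw [hu, AlgHom.commutes]
  replace hx := hπ hx
  replace hy := hπ hy
  replace hz := hπ hz
  replace h1 := hπ h1
  replace h1' := hπ h1'
  simp only [map_mul π, map_add π] at hx hy hz h1 h1'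
  have hyz := eq_of_relations_of_sq_add h2 hq hx hy hz h1 h1' he
  have hxy : π x * π y + π y * π x = algebraMap K _ (q - s ^ 2) := by
    rw [map_sub, ← h1, ← hy, hyz]
    abel
  have hπtop : Algebra.adjoin K {π x, π y} = ⊤ := by
    have := AlgHom.map_adjoin π {x, y, z}
    rw [htop, Algebra.map_top, (AlgHom.range_eq_top _).mpr (RingQuot.mkAlgHom_surjective K R),
      Set.image_insert_eq, Set.image_pair, ← hyz, Set.pair_eq_singleton] at this
    exact this.symm
  have hbij := bijective_of_clifford_pair (s := s) (r := q - s ^ 2)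
    (by convert h using 1; ring) hx hy hxy hπtop f
    ((hf x).trans hφx) ((hf y).trans hφy)
  let e := AlgEquiv.ofBijective f hbij
  exact ⟨IsSimpleRing.of_ringEquiv e.symm.toRingEquiv inferInstance, ⟨e⟩⟩

end Clifford

section D3

variable {K : Type} [Field K] (α1 α2 : K)

theorem adjoin_D3_generators :
    Algebra.adjoin K {D3a K α1 α2, D3b K α1 α2, D3c K α1 α2} = ⊤ := by
  have := AlgHom.map_adjoin (RingQuot.mkAlgHom K (D3Rel K α1 α2)) (Set.range (ι K))
  rw [FreeAlgebra.adjoin_range_ι, Algebra.map_top,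
    (AlgHom.range_eq_top _).mpr (RingQuot.mkAlgHom_surjective K _), ← Set.range_comp] at this
  rw [this]
  congr 1
  ext d
  simp [Fin.exists_fin_succ, D3a, D3b, D3c, eq_comm]

variable {α1 α2}

/-- The universal property of `D₃(α₁, α₂)`. -/
theorem exists_D3_algHom {B : Type*} [Ring B] [Algebra K B] {x y z : B}
    (hx : x * x = algebraMap K B α1) (hy : y * y = algebraMap K B α1)
    (hz : z * z = algebraMap K B α1) (h1 : z * x + y * z + x * y = algebraMap K B α2)
    (h2 : z * y + y * x + x * z = algebraMap K B α2) :
    ∃ φ : D3 K α1 α2 →ₐ[K] B,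
      φ (D3a K α1 α2) = x ∧ φ (D3b K α1 α2) = y ∧ φ (D3c K α1 α2) = z := by
  have hrel : ∀ ⦃u v⦄, D3Rel K α1 α2 u v → lift K ![x, y, z] u = lift K ![x, y, z] v := by
    rintro _ _ (_ | _ | _ | _ | _) <;> simp [*]
  exact ⟨RingQuot.liftAlgHom K ⟨_, hrel⟩, by simp [D3a, RingQuot.liftAlgHom_mkAlgHom_apply],
    by simp [D3b, RingQuot.liftAlgHom_mkAlgHom_apply],
    by simp [D3c, RingQuot.liftAlgHom_mkAlgHom_apply]⟩

end D3

theorem D3_ei_simple (K : Type) [Field K] [IsAlgClosed K] (hchar : ringChar K ≠ 2)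
    (α1 α2 : K) (h : (3 * α1 - α2) * (α1 + α2) ≠ 0) :
    (IsSimpleRing (RingQuot (fun x y : D3 K α1 α2 =>
        x = 1 - (3 * α1 - α2)⁻¹ •
          ((D3b K α1 α2 + D3c K α1 α2) ^ 2 - algebraMap K (D3 K α1 α2) (α1 + α2)) ∧
        y = 0)) ∧
      Nonempty ((RingQuot (fun x y : D3 K α1 α2 =>
        x = 1 - (3 * α1 - α2)⁻¹ •
          ((D3b K α1 α2 + D3c K α1 α2) ^ 2 - algebraMap K (D3 K α1 α2) (α1 + α2)) ∧
        y = 0)) ≃ₐ[K] Matrix (Fin 2) (Fin 2) K)) ∧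
    (IsSimpleRing (RingQuot (fun x y : D3 K α1 α2 =>
        x = 1 - (3 * α1 - α2)⁻¹ •
          ((D3a K α1 α2 + D3c K α1 α2) ^ 2 - algebraMap K (D3 K α1 α2) (α1 + α2)) ∧
        y = 0)) ∧
      Nonempty ((RingQuot (fun x y : D3 K α1 α2 =>
        x = 1 - (3 * α1 - α2)⁻¹ •
          ((D3a K α1 α2 + D3c K α1 α2) ^ 2 - algebraMap K (D3 K α1 α2) (α1 + α2)) ∧
        y = 0)) ≃ₐ[K] Matrix (Fin 2) (Fin 2) K)) ∧
    (IsSimpleRing (RingQuot (fun x y : D3 K α1 α2 =>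
        x = 1 - (3 * α1 - α2)⁻¹ •
          ((D3a K α1 α2 + D3b K α1 α2) ^ 2 - algebraMap K (D3 K α1 α2) (α1 + α2)) ∧
        y = 0)) ∧
      Nonempty ((RingQuot (fun x y : D3 K α1 α2 =>
        x = 1 - (3 * α1 - α2)⁻¹ •
          ((D3a K α1 α2 + D3b K α1 α2) ^ 2 - algebraMap K (D3 K α1 α2) (α1 + α2)) ∧
        y = 0)) ≃ₐ[K] Matrix (Fin 2) (Fin 2) K)) := by
  have two_ne : (2 : K) ≠ 0 := Ring.two_ne_zero hchar
  obtain ⟨s, rfl⟩ : ∃ s, α1 = s ^ 2 := by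
    obtain ⟨s, hs⟩ := IsAlgClosed.exists_pow_nat_eq α1 two_pos
    exact ⟨s, hs.symm⟩
  set D := D3 K (s ^ 2) α2
  set a : D := D3a K (s ^ 2) α2
  set b : D := D3b K (s ^ 2) α2
  set c : D := D3c K (s ^ 2) α2
  have ha : a * a = algebraMap K D (s ^ 2) := by
    simpa [a, D3a, -map_pow] using RingQuot.mkAlgHom_rel K (D3Rel.ra (α1 := s ^ 2) (α2 := α2))
  have hb : b * b = algebraMap K D (s ^ 2) := by
    simpa [b, D3b, -map_pow] using RingQuot.mkAlgHom_rel K (D3Rel.rb (α1 := s ^ 2) (α2 := α2))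
  have hc : c * c = algebraMap K D (s ^ 2) := by
    simpa [c, D3c, -map_pow] using RingQuot.mkAlgHom_rel K (D3Rel.rc (α1 := s ^ 2) (α2 := α2))
  have h1 : c * a + b * c + a * b = algebraMap K D α2 := by
    simpa [a, b, c, D3a, D3b, D3c] using
      RingQuot.mkAlgHom_rel K (D3Rel.r1 (α1 := s ^ 2) (α2 := α2))
  have h2 : c * b + b * a + a * c = algebraMap K D α2 := by
    simpa [a, b, c, D3a, D3b, D3c] using
      RingQuot.mkAlgHom_rel K (D3Rel.r2 (α1 := s ^ 2) (α2 := α2))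
  have htop : Algebra.adjoin K {a, b, c} = ⊤ := adjoin_D3_generators (s ^ 2) α2
  let X : Matrix (Fin 2) (Fin 2) K := !![0, 1; s ^ 2, 0]
  let Y : Matrix (Fin 2) (Fin 2) K := !![s, 0; α2 - s ^ 2, -s]
  have hX : X * X = algebraMap K _ (s ^ 2) := by
    ext i j
    fin_cases i <;> fin_cases j <;> simp [X, Matrix.algebraMap_matrix_apply]
  have hY : Y * Y = algebraMap K _ (s ^ 2) := by
    ext i j
    fin_cases i <;> fin_cases j <;> simp [Y, Matrix.algebraMap_matrix_apply] <;> ring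
  have hXY : X * Y + Y * X + Y * Y = algebraMap K _ α2 := by
    ext i j
    fin_cases i <;> fin_cases j <;> simp [X, Y, Matrix.algebraMap_matrix_apply] <;> ring
  refine ⟨?_, ?_, ?_⟩
  · obtain ⟨φ, hφa, hφb, hφc⟩ := exists_D3_algHom (α1 := s ^ 2) (α2 := α2) hX hY hY
      (by rw [← hXY]; abel) (by rw [← hXY]; abel)
    exact isSimpleRing_and_equiv_matrix_of_relations two_ne h ha hb hc h1 h2 htop φ
      hφa hφb hφc rfl
  · obtain ⟨φ, hφa, hφb, hφc⟩ := exists_D3_algHom (α1 := s ^ 2) (α2 := α2) hY hX hY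
      (by rw [← hXY]; abel) (by rw [← hXY]; abel)
    exact isSimpleRing_and_equiv_matrix_of_relations two_ne h hb ha hc
      (by rw [← h2]; abel) (by rw [← h1]; abel) (by rw [Set.insert_comm, htop]) φ
      hφb hφa hφc rfl
  · obtain ⟨φ, hφa, hφb, hφc⟩ := exists_D3_algHom (α1 := s ^ 2) (α2 := α2) hY hY hX
      hXY (by rw [← hXY]; abel)
    exact isSimpleRing_and_equiv_matrix_of_relations two_ne h hc ha hb
      (by rw [← h1]; abel) (by rw [← h2]; abel)
      (by rw [Set.insert_comm, Set.pair_comm, htop]) φ hφc hφa hφb rfl
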